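/- (Gibbs property) Let (X,T,φ) be as in Theorem 4.3 with φ additionally satisfying (H1), let {μ_ω} and λ be the random conformal measure and eigenvalue from Theorem 4.3, and set Λ_n(ω) = λ(ω)λ(θω)⋯λ(θ^{n−1}ω). If (X,T) has the big image property, then D_ω := inf{μ_ω(T_{θ^{−1}ω}([b]_{θ^{−1}ω})) : b ∈ W^1_{θ^{−1}ω}} > 0 for all ω ∈ Ω_bi, and for a.e. ω, every n with θ^nω ∈ Ω_bi, every a ∈ W^n_ω and every x ∈ [a]_ω: B_{θ^nω}^{−1} D_{θ^nω} ≤ Λ_n(ω) · μ_ω([a]_ω) / e^{φ^ω_n(x) − nP_G(φ)} ≤ B_{θ^nω}. -/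

import Mathlib

open MeasureTheory Filter Topology
open scoped Classical

noncomputable section

namespace RandomTMC

/-- A random countable topological Markov chain over an invertible base
transformation `θ` of `Ω`.  The alphabet availability `letterOK ω i` plays the
role of "`i < ℓ_ω`", and `tr ω i j` is the 0–1 transition matrix `α_{ij}(ω)`. -/
structure Chain (Ω : Type*) [MeasurableSpace Ω] where
  θ : Ω → Ω
  θinv : Ω → Ω
  θ_meas : Measurable θ
  θinv_meas : Measurable θinv
  θ_left_inv : Function.LeftInverse θinv θ
  θ_right_inv : Function.RightInverse θinv θ
  letterOK : Ω → ℕ → Bool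
  letterOK_meas : ∀ i, Measurable fun ω => letterOK ω i
  two_letters : ∀ ω, ∃ i j, i ≠ j ∧ letterOK ω i = true ∧ letterOK ω j = true
  tr : Ω → ℕ → ℕ → Bool
  tr_meas : ∀ i j, Measurable fun ω => tr ω i j
  no_zero_row : ∀ ω i, letterOK ω i = true → ∃ j, letterOK (θ ω) j = true ∧ tr ω i j = true

variable {Ω : Type*} [MeasurableSpace Ω]

/-- The fiber `X_ω ⊆ ℕ^ℕ`. -/
def fiber (S : Chain Ω) (ω : Ω) : Set (ℕ → ℕ) :=
  {x | ∀ n : ℕ, S.letterOK (S.θ^[n] ω) (x n) = true ∧ S.tr (S.θ^[n] ω) (x n) (x (n + 1)) = true}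

/-- The shift map `T_ω`. -/
def shift (x : ℕ → ℕ) : ℕ → ℕ := fun n => x (n + 1)

/-- The iterated shift `T^n_ω`. -/
def shiftIt (n : ℕ) (x : ℕ → ℕ) : ℕ → ℕ := fun k => x (k + n)

/-- `w` is an `ω`-admissible word. -/
def wordAdm (S : Chain Ω) (ω : Ω) (w : List ℕ) : Prop :=
  (∀ (i : ℕ) (h : i < w.length), S.letterOK (S.θ^[i] ω) (w.get ⟨i, h⟩) = true) ∧
  (∀ (i : ℕ) (h : i + 1 < w.length),
    S.tr (S.θ^[i] ω) (w.get ⟨i, Nat.lt_of_succ_lt h⟩) (w.get ⟨i + 1, h⟩) = true)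

/-- The cylinder set `[w]_ω`. -/
def cyl (S : Chain Ω) (ω : Ω) (w : List ℕ) : Set (ℕ → ℕ) :=
  {x | x ∈ fiber S ω ∧ ∀ (i : ℕ) (h : i < w.length), x i = w.get ⟨i, h⟩}

/-- `Ω_w = {ω : [w]_ω ≠ ∅}`. -/
def OmegaW (S : Chain Ω) (w : List ℕ) : Set Ω := {ω | (cyl S ω w).Nonempty}

/-- The Birkhoff sum `φ^ω_n(x)`. -/
def birk (S : Chain Ω) (φ : Ω → (ℕ → ℕ) → ℝ) (ω : Ω) (n : ℕ) (x : ℕ → ℕ) : ℝ :=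
  ∑ j ∈ Finset.range n, φ (S.θ^[j] ω) (shiftIt j x)

/-- Prepend a finite word to a sequence. -/
def prepend (w : List ℕ) (x : ℕ → ℕ) : ℕ → ℕ := fun n =>
  if h : n < w.length then w.get ⟨n, h⟩ else x (n - w.length)

/-- The iterated Ruelle transfer operator `L^{ω,n}_φ f (x)`. -/
def ruelleIt (S : Chain Ω) (φ : Ω → (ℕ → ℕ) → ℝ) (ω : Ω) (n : ℕ)
    (f : (ℕ → ℕ) → ℝ) (x : ℕ → ℕ) : ℝ :=
  ∑' w : List ℕ,
    if w.length = n ∧ prepend w x ∈ fiber S ω then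
      Real.exp (birk S φ ω n (prepend w x)) * f (prepend w x)
    else 0

/-- `M_ω = sup L^ω_φ(1)`. -/
def Mfun (S : Chain Ω) (φ : Ω → (ℕ → ℕ) → ℝ) (ω : Ω) : ℝ :=
  sSup ((fun x => ruelleIt S φ ω 1 (fun _ => (1 : ℝ)) x) '' fiber S (S.θ ω))

/-- `m_ω = inf L^ω_φ(1)`. -/
def mfun (S : Chain Ω) (φ : Ω → (ℕ → ℕ) → ℝ) (ω : Ω) : ℝ :=
  sInf ((fun x => ruelleIt S φ ω 1 (fun _ => (1 : ℝ)) x) '' fiber S (S.θ ω))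

/-- `B_ω = exp (∑_{k ≥ 1} κ(θ^{-k} ω) r^k)`. -/
def Bconst (S : Chain Ω) (κ : Ω → ℝ) (r : ℝ) (ω : Ω) : ℝ :=
  Real.exp (∑' k : ℕ, κ (S.θinv^[k + 1] ω) * r ^ (k + 1))

/-- `φ` is locally fiber Hölder continuous with index `k`, constants `κ, r`. -/
def HolderIdx (S : Chain Ω) (P : Measure Ω) (φ : Ω → (ℕ → ℕ) → ℝ)
    (κ : Ω → ℝ) (r : ℝ) (k : ℕ) : Prop :=
  0 < r ∧ r < 1 ∧ (∀ ω, 1 ≤ κ ω) ∧ Measurable κ ∧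
    Integrable (fun ω => Real.log (κ ω)) P ∧
    ∀ ω (n : ℕ), k ≤ n → ∀ x ∈ fiber S ω, ∀ y ∈ fiber S ω,
      (∀ i < n, x i = y i) → |φ ω x - φ ω y| ≤ κ ω * r ^ n

/-- `exp(φ^ω_n([w])) = sup {exp(φ^ω_n(x)) : x ∈ [w]_ω}`. -/
def supExp (S : Chain Ω) (φ : Ω → (ℕ → ℕ) → ℝ) (ω : Ω) (n : ℕ) (w : List ℕ) : ℝ :=
  sSup ((fun x => Real.exp (birk S φ ω n x)) '' cyl S ω w)

/-- The Gurevič partition function `Z^ω_n(a)`. -/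
def Zfun (S : Chain Ω) (φ : Ω → (ℕ → ℕ) → ℝ) (a : ℕ) (ω : Ω) (n : ℕ) : ℝ :=
  ∑' w : List ℕ,
    if w.length = n ∧ w.head? = some a ∧ wordAdm S ω (w ++ [a]) then
      supExp S φ ω n (w ++ [a])
    else 0

/-- `A^ω_n = ∑_{w ∈ W^n_ω} e^{φ^ω_n([w])}`. -/
def Afun (S : Chain Ω) (φ : Ω → (ℕ → ℕ) → ℝ) (ω : Ω) (n : ℕ) : ℝ :=
  ∑' w : List ℕ, if w.length = n ∧ wordAdm S ω w then supExp S φ ω n w else 0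

/-- The local preimage function `𝒵^ω_n(a) = L^{ω,n}_φ(1_{[a]})(ξ_{θ^n ω})`. -/
def locPre (S : Chain Ω) (φ : Ω → (ℕ → ℕ) → ℝ) (a : ℕ) (ξ : Ω → ℕ → ℕ) (ω : Ω) (n : ℕ) : ℝ :=
  ruelleIt S φ ω n (Set.indicator (cyl S ω [a]) fun _ => (1 : ℝ)) (ξ (S.θ^[n] ω))

/-- The preimage function `𝒵^ω_n = L^{ω,n}_φ(1)(ξ_{θ^n ω})`. -/
def preFun (S : Chain Ω) (φ : Ω → (ℕ → ℕ) → ℝ) (ξ : Ω → ℕ → ℕ) (ω : Ω) (n : ℕ) : ℝ :=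
  ruelleIt S φ ω n (fun _ => (1 : ℝ)) (ξ (S.θ^[n] ω))

/-- The mixing property for the pair `(a, b)` with mixing time `N = N_{ab}`. -/
def MixPair (S : Chain Ω) (a b : ℕ) (N : Ω → ℕ) : Prop :=
  ∀ ω (n : ℕ), N ω ≤ n → wordAdm S ω [a] → S.θ^[n] ω ∈ OmegaW S [b] →
    ∃ x ∈ cyl S ω [a], shiftIt n x ∈ cyl S (S.θ^[n] ω) [b]

/-- `(X, T)` is topologically mixing. -/
def TopMix (S : Chain Ω) (P : Measure Ω) : Prop :=
  ∀ a b : ℕ, 0 < P (OmegaW S [a]) → 0 < P (OmegaW S [b]) →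
    ∃ N : Ω → ℕ, Measurable N ∧ MixPair S a b N

/-- The big image property with base set `Ωbi`. -/
def BigIm (S : Chain Ω) (P : Measure Ω) (Ωbi : Set Ω) : Prop :=
  0 < P Ωbi ∧ ∀ ω ∈ Ωbi, ∃ I : Finset ℕ,
    (∀ b ∈ I, wordAdm S ω [b]) ∧
    ∀ a : ℕ, wordAdm S (S.θinv ω) [a] → ∃ b ∈ I, wordAdm S (S.θinv ω) [a, b]

/-- The big preimage property with base set `Ωbp`. -/
def BigPre (S : Chain Ω) (P : Measure Ω) (Ωbp : Set Ω) : Prop :=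
  0 < P Ωbp ∧ ∀ ω ∈ Ωbp, ∃ I : Finset ℕ,
    (∀ b ∈ I, wordAdm S (S.θinv ω) [b]) ∧
    ∀ a : ℕ, wordAdm S ω [a] → ∃ b ∈ I, wordAdm S (S.θinv ω) [b, a]

/-- Nonemptiness of `W^n_ω(a, b)`. -/
def WSetNe (S : Chain Ω) (ω : Ω) (n : ℕ) (a b : ℕ) : Prop :=
  ∃ w : List ℕ, w.length = n ∧ w.head? = some a ∧ wordAdm S ω (w ++ [b])

/-- The terms of the random power series `P_ω(s)`. -/
def PserTerm (S : Chain Ω) (φ : Ω → (ℕ → ℕ) → ℝ) (ξ : Ω → ℕ → ℕ)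
    (Ωt : Set Ω) (ω : Ω) (s : ℝ) : ℕ → ℝ := fun n =>
  if S.θ^[n] ω ∈ Ωt then s ^ n * preFun S φ ξ ω n else 0

/-- The random power series `P_ω(s) = ∑_{n ∈ J_ω(Ω̃)} s^n 𝒵^ω_n`. -/
def Pser (S : Chain Ω) (φ : Ω → (ℕ → ℕ) → ℝ) (ξ : Ω → ℕ → ℕ)
    (Ωt : Set Ω) (ω : Ω) (s : ℝ) : ℝ :=
  ∑' n : ℕ, PserTerm S φ ξ Ωt ω s n

/-- `(X, T, φ)` is of divergence type with witness set `Ω̃ = Ωt ⊆ Ω_a`. -/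
def DivType (S : Chain Ω) (P : Measure Ω) (φ : Ω → (ℕ → ℕ) → ℝ) (ξ : Ω → ℕ → ℕ)
    (a : ℕ) (Ωt : Set Ω) : Prop :=
  Ωt ⊆ OmegaW S [a] ∧
    (∀ᵐ ω ∂P, ∀ s : ℝ, 0 < s → s < 1 → Summable (PserTerm S φ ξ Ωt ω s)) ∧
    (∀ᵐ ω ∂P, ¬ Summable (PserTerm S φ ξ Ωt ω 1))

/-- The random measure `μ_{ω,s}`. -/
def muMeas (S : Chain Ω) (φ : Ω → (ℕ → ℕ) → ℝ) (ξ : Ω → ℕ → ℕ)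
    (Ωt : Set Ω) (ω : Ω) (s : ℝ) : Measure (ℕ → ℕ) :=
  (ENNReal.ofReal (Pser S φ ξ Ωt ω s))⁻¹ •
    Measure.sum fun q : ℕ × List ℕ =>
      if S.θ^[q.1] ω ∈ Ωt ∧ q.2.length = q.1 ∧ prepend q.2 (ξ (S.θ^[q.1] ω)) ∈ fiber S ω then
        ENNReal.ofReal (s ^ q.1 * Real.exp (birk S φ ω q.1 (prepend q.2 (ξ (S.θ^[q.1] ω))))) •
          Measure.dirac (prepend q.2 (ξ (S.θ^[q.1] ω)))
      else 0

/-- `Λ_n(ω) = λ(ω) λ(θω) ⋯ λ(θ^{n-1}ω)`. -/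
def Lam (S : Chain Ω) (lam : Ω → ℝ) (ω : Ω) (n : ℕ) : ℝ :=
  ∏ j ∈ Finset.range n, lam (S.θ^[j] ω)

/-- The matrix product `(A^ω A^{θω} ⋯ A^{θ^{n-1}ω})_{ij}`. -/
def matProd (S : Chain Ω) (p : Ω → ℕ → ℕ → ℝ) (ω : Ω) : ℕ → ℕ → ℕ → ℝ
  | 0 => fun i j => if i = j then 1 else 0
  | n + 1 => fun i j => ∑' k : ℕ, matProd S p ω n i k * p (S.θ^[n] ω) k j

/-- The iterated matrix-vector product `(A^{θ^{-n}ω} ⋯ A^{θ^{-1}ω} f)_j`, where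
`S.θ` is the inverse `θ^{-1}` of the base map of the original system. -/
def matVecIt (S : Chain Ω) (p : Ω → ℕ → ℕ → ℝ) (ω : Ω) (f : ℕ → ℝ) : ℕ → ℕ → ℝ
  | 0 => f
  | n + 1 => fun j => ∑' i : ℕ, p (S.θ^[n + 1] ω) j i * matVecIt S p ω f n i

section Words

variable {S : Chain Ω} {ω : Ω} {w : List ℕ} {x : ℕ → ℕ} {a b : ℕ}

lemma wordAdm_singleton : wordAdm S ω [a] ↔ S.letterOK ω a = true := by
  constructor
  · intro h
    exact h.1 0 (by simp)
  · intro h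
    refine ⟨fun i hi => ?_, fun i hi => ?_⟩
    · obtain rfl : i = 0 := by simpa using hi
      exact h
    · simp at hi

lemma wordAdm.tail (h : wordAdm S ω (a :: w)) : wordAdm S (S.θ ω) w :=
  ⟨fun i hi => h.1 (i + 1) (by simpa using hi), fun i hi => h.2 (i + 1) (by simpa using hi)⟩

lemma wordAdm.letterOK_head (h : wordAdm S ω (a :: w)) : S.letterOK ω a = true :=
  h.1 0 (by simp)

lemma wordAdm.tr_head (h : wordAdm S ω (a :: b :: w)) : S.tr ω a b = true :=
  h.2 0 (by simp)

lemma shift_mem_fiber (hx : x ∈ fiber S ω) : shift x ∈ fiber S (S.θ ω) :=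
  fun n => hx (n + 1)

lemma shift_mem_cyl (hx : x ∈ cyl S ω (a :: w)) : shift x ∈ cyl S (S.θ ω) w :=
  ⟨shift_mem_fiber hx.1, fun i hi => hx.2 (i + 1) (by simpa using hi)⟩

/-- A sequence may be extended to the left by any letter allowed by the transition matrix. -/
lemma mem_shift_image_cyl (ha : S.letterOK ω a = true) (hx : x ∈ cyl S (S.θ ω) w)
    (htr : S.tr ω a (x 0) = true) : x ∈ shift '' cyl S ω (a :: w) := by
  refine ⟨fun n => n.casesOn a x, ⟨fun n => ?_, fun i hi => ?_⟩, rfl⟩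
  · cases n with
    | zero => exact ⟨ha, htr⟩
    | succ n => exact hx.1 n
  · cases i with
    | zero => rfl
    | succ i => exact hx.2 i (by simpa using hi)

lemma cyl_subset_shift_image_cyl_singleton (h : wordAdm S ω [a, b]) :
    cyl S (S.θ ω) [b] ⊆ shift '' cyl S ω [a] := by
  intro x hx
  have hx0 : x 0 = b := hx.2 0 (by simp)
  exact mem_shift_image_cyl h.letterOK_head ⟨hx.1, by simp⟩ (hx0 ▸ h.tr_head)

lemma shift_image_cyl_cons_cons (h : wordAdm S ω (a :: b :: w)) :
    shift '' cyl S ω (a :: b :: w) = cyl S (S.θ ω) (b :: w) := by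
  apply Set.Subset.antisymm
  · rintro _ ⟨x, hx, rfl⟩
    exact shift_mem_cyl hx
  · intro x hx
    have hx0 : x 0 = b := hx.2 0 (by simp)
    exact mem_shift_image_cyl h.letterOK_head hx (hx0 ▸ h.tr_head)

lemma measurableSet_fiber : MeasurableSet (fiber S ω) := by
  have h : fiber S ω = ⋂ n : ℕ, {x | S.letterOK (S.θ^[n] ω) (x n) = true} ∩
      {x | S.tr (S.θ^[n] ω) (x n) (x (n + 1)) = true} := by
    ext x; simp [fiber]
  rw [h]
  refine MeasurableSet.iInter fun n => MeasurableSet.inter ?_ ?_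
  · exact measurableSet_preimage (f := fun x : ℕ → ℕ => x n) (measurable_pi_apply n)
      (t := {k | S.letterOK (S.θ^[n] ω) k = true}) .of_discrete
  · exact measurableSet_preimage (f := fun x : ℕ → ℕ => (x n, x (n + 1))) (by fun_prop)
      (t := {q | S.tr (S.θ^[n] ω) q.1 q.2 = true}) .of_discrete

lemma measurableSet_cyl : MeasurableSet (cyl S ω w) := by
  have h : cyl S ω w = fiber S ω ∩ ⋂ i : Fin w.length, {x | x i = w.get i} := by
    ext x; simp [cyl, Fin.forall_iff]
  rw [h]
  refine measurableSet_fiber.inter (MeasurableSet.iInter fun i => ?_)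
  exact measurableSet_preimage (f := fun x : ℕ → ℕ => x i) (measurable_pi_apply (i : ℕ))
    (measurableSet_singleton (w.get i))

lemma birk_succ (φ : Ω → (ℕ → ℕ) → ℝ) (n : ℕ) :
    birk S φ ω (n + 1) x = φ ω x + birk S φ (S.θ ω) n (shift x) := by
  rw [birk, Finset.sum_range_succ', add_comm]
  rfl

lemma Lam_succ (lam : Ω → ℝ) (n : ℕ) : Lam S lam ω (n + 1) = lam ω * Lam S lam (S.θ ω) n := by
  rw [Lam, Finset.prod_range_succ', mul_comm]
  rfl

lemma θinv_iterate_θ_iterate (j k : ℕ) :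
    S.θinv^[k] (S.θ^[k + j] ω) = S.θ^[j] ω := by
  rw [Function.iterate_add_apply]
  exact S.θ_left_inv.iterate k _

end Words

section Potential

variable {S : Chain Ω} {P : Measure Ω} {φ : Ω → (ℕ → ℕ) → ℝ} {κ : Ω → ℝ} {r : ℝ} {ω : Ω}
  {w : List ℕ} {x : ℕ → ℕ}

lemma HolderIdx.abs_sub_le (hφ : HolderIdx S P φ κ r 1) (hw : 1 ≤ w.length)
    {y : ℕ → ℕ} (hx : x ∈ cyl S ω w) (hy : y ∈ cyl S ω w) :
    |φ ω x - φ ω y| ≤ κ ω * r ^ w.length :=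
  hφ.2.2.2.2.2 ω w.length hw x hx.1 y hy.1 fun i hi => (hx.2 i hi).trans (hy.2 i hi).symm

lemma HolderIdx.continuousOn (hφ : HolderIdx S P φ κ r 1) :
    ContinuousOn (φ ω) (fiber S ω) := by
  obtain ⟨hr0, hr1, -, -, -, hH⟩ := hφ
  intro x hx
  refine Metric.tendsto_nhds.2 fun ε hε => ?_
  have hlim : Tendsto (fun n : ℕ => κ ω * r ^ n) atTop (𝓝 0) := by
    simpa using (tendsto_pow_atTop_nhds_zero_of_lt_one hr0.le hr1).const_mul (κ ω)
  obtain ⟨n, hnε, hn⟩ := ((hlim.eventually_lt_const hε).and (eventually_ge_atTop 1)).exists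
  have hopen : ∀ᶠ y in 𝓝 x, ∀ i ∈ Finset.range n, y i = x i := by
    refine (Finset.eventually_all _).2 fun i _ => ?_
    exact (continuous_apply i).continuousAt.eventually
      ((isOpen_discrete {x i}).mem_nhds rfl)
  filter_upwards [self_mem_nhdsWithin, mem_nhdsWithin_of_mem_nhds hopen] with y hy hyx
  exact (hH ω n hn y hy x hx fun i hi => hyx i (Finset.mem_range.2 hi)).trans_lt hnε

lemma HolderIdx.integrableOn_exp_sub (hφ : HolderIdx S P φ κ r 1) (hw : 1 ≤ w.length)
    (hx : x ∈ cyl S ω w) (c : ℝ) (ν : Measure (ℕ → ℕ)) [IsFiniteMeasure ν] :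
    IntegrableOn (fun y => Real.exp (c - φ ω y)) (cyl S ω w) ν := by
  have hcont : ContinuousOn (fun y => Real.exp (c - φ ω y)) (cyl S ω w) :=
    (continuousOn_const.sub (hφ.continuousOn.mono fun _ hy => hy.1)).rexp
  refine IntegrableOn.of_bound (measure_lt_top _ _)
    (hcont.aestronglyMeasurable measurableSet_cyl)
    (Real.exp (c - φ ω x + κ ω * r ^ w.length)) ?_
  refine (ae_restrict_iff' measurableSet_cyl).2 (Eventually.of_forall fun y hy => ?_)
  rw [Real.norm_of_nonneg (Real.exp_pos _).le, Real.exp_le_exp]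
  linarith [(abs_le.1 (hφ.abs_sub_le hw hx hy)).2]

/-- Bounded distortion for the integral of the conformal Jacobian over a cylinder. -/
lemma HolderIdx.setIntegral_exp_sub_bounds (hφ : HolderIdx S P φ κ r 1) (hw : 1 ≤ w.length)
    (hx : x ∈ cyl S ω w) (c : ℝ) (ν : Measure (ℕ → ℕ)) [IsFiniteMeasure ν] :
    Real.exp (c - φ ω x - κ ω * r ^ w.length) * (ν (cyl S ω w)).toReal ≤
        ∫ y in cyl S ω w, Real.exp (c - φ ω y) ∂ν ∧
      ∫ y in cyl S ω w, Real.exp (c - φ ω y) ∂ν ≤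
        Real.exp (c - φ ω x + κ ω * r ^ w.length) * (ν (cyl S ω w)).toReal := by
  have hint := hφ.integrableOn_exp_sub hw hx c ν
  have hconst (C : ℝ) : ∫ _ in cyl S ω w, C ∂ν = C * (ν (cyl S ω w)).toReal := by
    rw [setIntegral_const, smul_eq_mul, mul_comm]
    rfl
  rw [← hconst, ← hconst]
  constructor
  · refine setIntegral_mono_on (integrableOn_const (measure_ne_top _ _)) hint
      measurableSet_cyl fun y hy => Real.exp_le_exp.2 ?_
    linarith [(abs_le.1 (hφ.abs_sub_le hw hx hy)).1]
  · refine setIntegral_mono_on hint (integrableOn_const (measure_ne_top _ _))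
      measurableSet_cyl fun y hy => Real.exp_le_exp.2 ?_
    linarith [(abs_le.1 (hφ.abs_sub_le hw hx hy)).2]

end Potential

/-- The conformality of `μ` at `ω`: on measurable subsets of cylinders, `shift` has Jacobian
`lam ω * exp (PG - φ ω)`. -/
def ConformalAt (S : Chain Ω) (φ : Ω → (ℕ → ℕ) → ℝ) (PG : ℝ) (lam : Ω → ℝ)
    (μ : Ω → Measure (ℕ → ℕ)) (ω : Ω) : Prop :=
  ∀ w : List ℕ, 1 ≤ w.length → wordAdm S ω w →
    ∀ A : Set (ℕ → ℕ), MeasurableSet A → A ⊆ cyl S ω w →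
      (μ (S.θ ω) (shift '' A)).toReal = lam ω * ∫ x in A, Real.exp (PG - φ ω x) ∂(μ ω)

section Conformal

variable {S : Chain Ω} {P : Measure Ω} {φ : Ω → (ℕ → ℕ) → ℝ} {κ : Ω → ℝ} {r PG : ℝ}
  {lam : Ω → ℝ} {μ : Ω → Measure (ℕ → ℕ)}

/-- The quotient compared with a constant in the Gibbs property. -/
def gibbsRatio (S : Chain Ω) (φ : Ω → (ℕ → ℕ) → ℝ) (PG : ℝ) (lam : Ω → ℝ)
    (μ : Ω → Measure (ℕ → ℕ)) (ω : Ω) (w : List ℕ) (x : ℕ → ℕ) : ℝ :=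
  Lam S lam ω w.length * (μ ω (cyl S ω w)).toReal /
    Real.exp (birk S φ ω w.length x - w.length * PG)

/-- The accumulated Hölder distortion of the Birkhoff sum over a cylinder of length `n`. -/
def distortion (S : Chain Ω) (κ : Ω → ℝ) (r : ℝ) (ω : Ω) (n : ℕ) : ℝ :=
  ∑ j ∈ Finset.range n, κ (S.θ^[j] ω) * r ^ (n - j)

lemma distortion_succ (ω : Ω) (n : ℕ) :
    distortion S κ r ω (n + 1) = κ ω * r ^ (n + 1) + distortion S κ r (S.θ ω) n := by
  rw [distortion, Finset.sum_range_succ', add_comm]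
  simp [distortion]

lemma distortion_eq_sum_θinv (ω : Ω) (n : ℕ) :
    distortion S κ r ω n =
      ∑ k ∈ Finset.range n, κ (S.θinv^[k + 1] (S.θ^[n] ω)) * r ^ (k + 1) := by
  rw [distortion, ← Finset.sum_range_reflect]
  refine Finset.sum_congr rfl fun k hk => ?_
  have hk := Finset.mem_range.1 hk
  have hsub : n - (n - 1 - k) = k + 1 := by omega
  have hadd : n = (k + 1) + (n - 1 - k) := by omega
  have hθ : S.θinv^[k + 1] (S.θ^[n] ω) = S.θ^[n - 1 - k] ω := by
    conv_lhs => rw [hadd]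
    exact θinv_iterate_θ_iterate _ _
  rw [hsub, hθ]

lemma exp_distortion_le_Bconst (hφ : HolderIdx S P φ κ r 1) (ω : Ω) (n : ℕ)
    (hsum : Summable fun k : ℕ => κ (S.θinv^[k + 1] (S.θ^[n] ω)) * r ^ (k + 1)) :
    Real.exp (distortion S κ r ω n) ≤ Bconst S κ r (S.θ^[n] ω) := by
  obtain ⟨hr0, -, hκ, -⟩ := hφ
  rw [distortion_eq_sum_θinv, Bconst, Real.exp_le_exp]
  exact hsum.sum_le_tsum _ fun k _ =>
    mul_nonneg (zero_le_one.trans (hκ _)) (pow_nonneg hr0.le _)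

/-- One step of the conformality relation, with bounded distortion. -/
lemma ConformalAt.shift_image_bounds (hφ : HolderIdx S P φ κ r 1) {ω : Ω}
    (hconf : ConformalAt S φ PG lam μ ω) (hlam : 0 < lam ω) [IsFiniteMeasure (μ ω)]
    {w : List ℕ} (hw : 1 ≤ w.length) (hadm : wordAdm S ω w) {x : ℕ → ℕ} (hx : x ∈ cyl S ω w) :
    Real.exp (-(κ ω * r ^ w.length)) * (μ (S.θ ω) (shift '' cyl S ω w)).toReal ≤
        lam ω * Real.exp (PG - φ ω x) * (μ ω (cyl S ω w)).toReal ∧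
      lam ω * Real.exp (PG - φ ω x) * (μ ω (cyl S ω w)).toReal ≤
        Real.exp (κ ω * r ^ w.length) * (μ (S.θ ω) (shift '' cyl S ω w)).toReal := by
  obtain ⟨hlow, hupp⟩ := hφ.setIntegral_exp_sub_bounds hw hx PG (μ ω)
  rw [hconf w hw hadm _ measurableSet_cyl subset_rfl]
  set E := κ ω * r ^ w.length
  set m := (μ ω (cyl S ω w)).toReal
  set J := ∫ y in cyl S ω w, Real.exp (PG - φ ω y) ∂(μ ω)
  have hE : Real.exp (-E) * Real.exp E = 1 := by rw [← Real.exp_add]; simp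
  rw [sub_eq_add_neg _ E, Real.exp_add] at hlow
  rw [Real.exp_add] at hupp
  constructor
  · calc Real.exp (-E) * (lam ω * J)
        ≤ Real.exp (-E) * (lam ω * (Real.exp (PG - φ ω x) * Real.exp E * m)) := by gcongr
      _ = (Real.exp (-E) * Real.exp E) * (lam ω * Real.exp (PG - φ ω x) * m) := by ring
      _ = _ := by rw [hE, one_mul]
  · calc lam ω * Real.exp (PG - φ ω x) * m
        = (Real.exp (-E) * Real.exp E) * (lam ω * Real.exp (PG - φ ω x) * m) := by
          rw [hE, one_mul]
      _ = Real.exp E * (lam ω * (Real.exp (PG - φ ω x) * Real.exp (-E) * m)) := by ring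
      _ ≤ Real.exp E * (lam ω * J) := by gcongr

lemma gibbsRatio_cons (ω : Ω) (a : ℕ) (w : List ℕ) (x : ℕ → ℕ) :
    gibbsRatio S φ PG lam μ ω (a :: w) x =
      lam ω * Real.exp (PG - φ ω x) * (μ ω (cyl S ω (a :: w))).toReal *
        (Lam S lam (S.θ ω) w.length /
          Real.exp (birk S φ (S.θ ω) w.length (shift x) - w.length * PG)) := by
  have hexp : birk S φ ω (w.length + 1) x - ((w.length + 1 : ℕ) : ℝ) * PG =
      (birk S φ (S.θ ω) w.length (shift x) - w.length * PG) - (PG - φ ω x) := by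
    rw [birk_succ]; push_cast; ring
  rw [gibbsRatio, List.length_cons, Lam_succ, hexp, Real.exp_sub _ (PG - φ ω x)]
  field_simp

/-- Along a conformal orbit the Gibbs ratio of a nonempty word is, up to distortion, the measure
of the image of the cylinder. -/
lemma gibbsRatio_bounds (hφ : HolderIdx S P φ κ r 1) (d : ℝ) (w : List ℕ) (hw : w ≠ []) (ω : Ω)
    (hgood : ∀ j, 0 < lam (S.θ^[j] ω) ∧ IsProbabilityMeasure (μ (S.θ^[j] ω)) ∧
      ConformalAt S φ PG lam μ (S.θ^[j] ω))
    (hd : ∀ b, wordAdm S (S.θ^[w.length - 1] ω) [b] →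
      d ≤ (μ (S.θ^[w.length] ω) (shift '' cyl S (S.θ^[w.length - 1] ω) [b])).toReal)
    (hadm : wordAdm S ω w) (x : ℕ → ℕ) (hx : x ∈ cyl S ω w) :
    Real.exp (-distortion S κ r ω w.length) * d ≤ gibbsRatio S φ PG lam μ ω w x ∧
      gibbsRatio S φ PG lam μ ω w x ≤ Real.exp (distortion S κ r ω w.length) := by
  induction w generalizing ω x with
  | nil => exact absurd rfl hw
  | cons a w ih =>
    obtain ⟨hlam, hprob, hconf⟩ := hgood 0
    simp only [Function.iterate_zero, id] at hlam hprob hconf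
    obtain ⟨hlow, hupp⟩ :=
      hconf.shift_image_bounds hφ hlam (w := a :: w) (by simp) hadm hx
    rw [gibbsRatio_cons, List.length_cons, distortion_succ]
    rw [List.length_cons] at hlow hupp
    cases w with
    | nil =>
      have hd' : d ≤ (μ (S.θ ω) (shift '' cyl S ω [a])).toReal := hd a hadm
      have : IsProbabilityMeasure (μ (S.θ ω)) := (hgood 1).2.1
      have h1 : (μ (S.θ ω) (shift '' cyl S ω [a])).toReal ≤ 1 :=
        measureReal_le_one (μ := μ (S.θ ω))
      have hQ : Lam S lam (S.θ ω) 0 /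
          Real.exp (birk S φ (S.θ ω) 0 (shift x) - ((0 : ℕ) : ℝ) * PG) = 1 := by
        simp [Lam, birk]
      have hz : distortion S κ r (S.θ ω) 0 = 0 := by simp [distortion]
      rw [List.length_nil, hQ, hz, mul_one, add_zero]
      exact ⟨(mul_le_mul_of_nonneg_left hd' (Real.exp_pos _).le).trans hlow,
        hupp.trans (mul_le_of_le_one_right (Real.exp_pos _).le h1)⟩
    | cons b w =>
      obtain ⟨ihl, ihu⟩ := ih (by simp) (S.θ ω) (fun j => hgood (j + 1)) hd hadm.tail (shift x)
        (shift_mem_cyl hx)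
      rw [shift_image_cyl_cons_cons hadm] at hlow hupp
      have hLam : 0 < Lam S lam (S.θ ω) (b :: w).length :=
        Finset.prod_pos fun j _ => (hgood (j + 1)).1
      set Q := Lam S lam (S.θ ω) (b :: w).length /
        Real.exp (birk S φ (S.θ ω) (b :: w).length (shift x) - (b :: w).length * PG) with hQdef
      have hQ : 0 < Q := div_pos hLam (Real.exp_pos _)
      have hratio : gibbsRatio S φ PG lam μ (S.θ ω) (b :: w) (shift x) =
          (μ (S.θ ω) (cyl S (S.θ ω) (b :: w))).toReal * Q := by
        rw [gibbsRatio, hQdef]; ring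
      rw [hratio] at ihl ihu
      rw [neg_add, Real.exp_add, Real.exp_add]
      constructor
      · refine le_trans ?_ (mul_le_mul_of_nonneg_right hlow hQ.le)
        rw [mul_assoc, mul_assoc]
        exact mul_le_mul_of_nonneg_left ihl (Real.exp_pos _).le
      · refine (mul_le_mul_of_nonneg_right hupp hQ.le).trans ?_
        rw [mul_assoc]
        exact mul_le_mul_of_nonneg_left ihu (Real.exp_pos _).le

end Conformal

section AlmostEverywhere

variable {P : Measure Ω} {S : Chain Ω}

lemma measurePreserving_θinv (hθ : MeasurePreserving S.θ P P) : MeasurePreserving S.θinv P P :=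
  MeasurePreserving.symm
    { toFun := S.θ, invFun := S.θinv, left_inv := S.θ_left_inv, right_inv := S.θ_right_inv
      measurable_toFun := S.θ_meas, measurable_invFun := S.θinv_meas } hθ

lemma ae_forall_iterate (hθ : MeasurePreserving S.θ P P) {p : Ω → Prop} (h : ∀ᵐ ω ∂P, p ω) :
    ∀ᵐ ω ∂P, ∀ n : ℕ, p (S.θ^[n] ω) :=
  ae_all_iff.2 fun n => (hθ.iterate n).quasiMeasurePreserving.ae h

/-- An integrable nonnegative function grows sublinearly along almost every orbit. -/
lemma ae_eventually_iterate_le [IsProbabilityMeasure P] {τ : Ω → Ω}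
    (hτ : MeasurePreserving τ P P) {X : Ω → ℝ} (hX : Measurable X) (hint : Integrable X P)
    (hnonneg : 0 ≤ X) : ∀ᵐ ω ∂P, ∀ᶠ k : ℕ in atTop, X (τ^[k] ω) ≤ k := by
  let _ : MeasureSpace Ω := ⟨P⟩
  have hset (k : ℕ) : P {ω | (k : ℝ) < X (τ^[k] ω)} = P {ω | X ω ∈ Set.Ioi (k : ℝ)} :=
    (hτ.iterate k).measure_preimage (hX measurableSet_Ioi).nullMeasurableSet
  have hsum : ∑' k : ℕ, P {ω | (k : ℝ) < X (τ^[k] ω)} ≠ ⊤ := by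
    simp_rw [hset]
    exact (ProbabilityTheory.tsum_prob_mem_Ioi_lt_top hint hnonneg).ne
  filter_upwards [ae_eventually_notMem hsum] with ω hω
  filter_upwards [hω] with k hk
  exact not_lt.1 hk

lemma HolderIdx.ae_summable [IsProbabilityMeasure P] {φ : Ω → (ℕ → ℕ) → ℝ} {κ : Ω → ℝ} {r : ℝ}
    (hθ : MeasurePreserving S.θ P P) (hφ : HolderIdx S P φ κ r 1) :
    ∀ᵐ ω ∂P, Summable fun k : ℕ => κ (S.θinv^[k + 1] ω) * r ^ (k + 1) := by
  obtain ⟨hr0, hr1, hκ, hκm, hκi, -⟩ := hφ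
  set ε : ℝ := -Real.log r / 2 with hε
  have hεpos : 0 < ε := by
    have := Real.log_neg hr0 hr1
    linarith
  have hae := ae_eventually_iterate_le (measurePreserving_θinv hθ)
    (X := fun ω => Real.log (κ ω) / ε) (by fun_prop) (hκi.div_const ε)
    (fun ω => div_nonneg (Real.log_nonneg (hκ ω)) hεpos.le)
  filter_upwards [hae] with ω hω
  refine (summable_nat_add_iff (f := fun k : ℕ => κ (S.θinv^[k] ω) * r ^ k) 1).2 ?_
  have hgeo : Summable fun k : ℕ => Real.exp (-ε) ^ k :=
    summable_geometric_of_lt_one (Real.exp_pos _).le (Real.exp_lt_one_iff.2 (by linarith))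
  refine hgeo.of_norm_bounded_eventually_nat ?_
  filter_upwards [hω] with k hk
  have hκpos : 0 < κ (S.θinv^[k] ω) := zero_lt_one.trans_le (hκ _)
  rw [Real.norm_of_nonneg (mul_nonneg hκpos.le (pow_nonneg hr0.le _)), ← Real.exp_nat_mul,
    ← Real.log_le_iff_le_exp (mul_pos hκpos (pow_pos hr0 _)),
    Real.log_mul hκpos.ne' (pow_pos hr0 _).ne', Real.log_pow]
  have hk' := (div_le_iff₀ hεpos).1 hk
  have hlog : Real.log r = -2 * ε := by rw [hε]; ring
  rw [hlog]
  linarith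

end AlmostEverywhere

section BigImage

variable {S : Chain Ω} {P : Measure Ω} {Ωbi : Set Ω}

/-- The big image constant `D_ω` is positive. -/
lemma BigIm.sInf_pos (hbi : BigIm S P Ωbi) {ω : Ω} (hω : ω ∈ Ωbi) (ν : Measure (ℕ → ℕ))
    [IsFiniteMeasure ν] (hν : ∀ w : List ℕ, wordAdm S ω w → 0 < ν (cyl S ω w)) :
    0 < sInf ((fun b => (ν (shift '' cyl S (S.θinv ω) [b])).toReal) ''
      {b : ℕ | wordAdm S (S.θinv ω) [b]}) := by
  obtain ⟨I, hI, hIm⟩ := hbi.2 ω hω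
  obtain ⟨a, -, -, ha, -⟩ := S.two_letters (S.θinv ω)
  have ha : wordAdm S (S.θinv ω) [a] := wordAdm_singleton.2 ha
  obtain ⟨b, hb, -⟩ := hIm a ha
  obtain ⟨c, hc, hmin⟩ := I.exists_min_image (fun b => (ν (cyl S ω [b])).toReal) ⟨b, hb⟩
  refine (ENNReal.toReal_pos (hν [c] (hI c hc)).ne' (measure_ne_top _ _)).trans_le
    (le_csInf ⟨_, a, ha, rfl⟩ ?_)
  rintro _ ⟨a', ha', rfl⟩
  obtain ⟨b', hb', hab⟩ := hIm a' ha'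
  refine (hmin b' hb').trans (ENNReal.toReal_mono (measure_ne_top _ _) (measure_mono ?_))
  have hsub := cyl_subset_shift_image_cyl_singleton hab
  rwa [S.θ_right_inv ω] at hsub

lemma sInf_le_image (ω : Ω) (ν : Measure (ℕ → ℕ)) {b : ℕ} (hb : wordAdm S (S.θinv ω) [b]) :
    sInf ((fun b => (ν (shift '' cyl S (S.θinv ω) [b])).toReal) ''
      {b : ℕ | wordAdm S (S.θinv ω) [b]}) ≤ (ν (shift '' cyl S (S.θinv ω) [b])).toReal := by
  refine csInf_le ⟨0, ?_⟩ ⟨b, hb, rfl⟩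
  rintro _ ⟨_, -, rfl⟩
  exact ENNReal.toReal_nonneg

lemma sInf_le_fiber (ω : Ω) (ν : Measure (ℕ → ℕ)) [IsFiniteMeasure ν] :
    sInf ((fun b => (ν (shift '' cyl S (S.θinv ω) [b])).toReal) ''
      {b : ℕ | wordAdm S (S.θinv ω) [b]}) ≤ (ν (cyl S ω [])).toReal := by
  obtain ⟨a, -, -, ha, -⟩ := S.two_letters (S.θinv ω)
  refine (sInf_le_image ω ν (wordAdm_singleton.2 ha)).trans
    (ENNReal.toReal_mono (measure_ne_top _ _) (measure_mono ?_))
  rintro _ ⟨x, hx, rfl⟩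
  have hmem := shift_mem_cyl hx
  rwa [S.θ_right_inv ω] at hmem

end BigImage

/-- the Gibbs property of the random conformal measure under (H1)
and the big image property. -/
theorem gibbs_property
    {Ω : Type*} [MeasurableSpace Ω] (P : Measure Ω) [IsProbabilityMeasure P]
    (S : Chain Ω) (hθ : Ergodic S.θ P)
    (φ : Ω → (ℕ → ℕ) → ℝ) (κ : Ω → ℝ) (r : ℝ)
    (hmix : TopMix S P)
    -- (H1):
    (hφ : HolderIdx S P φ κ r 1)
    (hB : Integrable (fun ω => Real.log (Bconst S κ r ω)) P)
    (hS1 : Integrable (fun ω => Real.log (Mfun S φ ω)) P)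
    (hS2 : Integrable (fun ω => Real.log (mfun S φ ω)) P)
    -- big image property:
    (Ωbi : Set Ω) (hbi : BigIm S P Ωbi)
    (PG : ℝ)
    -- the objects produced by Theorem 4.3:
    (lam : Ω → ℝ) (μ : Ω → Measure (ℕ → ℕ))
    (hlam_pos : ∀ᵐ ω ∂P, 0 < lam ω)
    (hlam_int : Integrable (fun ω => Real.log (lam ω)) P)
    (hlam_zero : (∫ ω, Real.log (lam ω) ∂P) = 0)
    (hμ_prob : ∀ᵐ ω ∂P, IsProbabilityMeasure (μ ω))
    (hμ_cyl : ∀ᵐ ω ∂P, ∀ w : List ℕ, wordAdm S ω w → 0 < μ ω (cyl S ω w))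
    (hconf : ∀ᵐ ω ∂P, ∀ w : List ℕ, 1 ≤ w.length → wordAdm S ω w →
      ∀ A : Set (ℕ → ℕ), MeasurableSet A → A ⊆ cyl S ω w →
        (μ (S.θ ω) (shift '' A)).toReal =
          lam ω * ∫ x in A, Real.exp (PG - φ ω x) ∂(μ ω)) :
    (∀ᵐ ω ∂P, ω ∈ Ωbi →
      0 < sInf ((fun b => (μ ω (shift '' cyl S (S.θinv ω) [b])).toReal) ''
        {b : ℕ | wordAdm S (S.θinv ω) [b]})) ∧
    ∀ᵐ ω ∂P, ∀ n : ℕ, S.θ^[n] ω ∈ Ωbi →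
      ∀ w : List ℕ, w.length = n → wordAdm S ω w → ∀ x ∈ cyl S ω w,
        (Bconst S κ r (S.θ^[n] ω))⁻¹ *
            sInf ((fun b => (μ (S.θ^[n] ω)
              (shift '' cyl S (S.θinv (S.θ^[n] ω)) [b])).toReal) ''
              {b : ℕ | wordAdm S (S.θinv (S.θ^[n] ω)) [b]}) ≤
          Lam S lam ω n * (μ ω (cyl S ω w)).toReal /
            Real.exp (birk S φ ω n x - n * PG) ∧
        Lam S lam ω n * (μ ω (cyl S ω w)).toReal /
            Real.exp (birk S φ ω n x - n * PG) ≤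
          Bconst S κ r (S.θ^[n] ω) := by
  have hθ' := hθ.toMeasurePreserving
  refine ⟨?_, ?_⟩
  · filter_upwards [hμ_prob, hμ_cyl] with ω hprob hcyl hω
    exact hbi.sInf_pos hω (μ ω) hcyl
  · filter_upwards [ae_forall_iterate hθ' hlam_pos, ae_forall_iterate hθ' hμ_prob,
      ae_forall_iterate hθ' hconf, ae_forall_iterate hθ' (hφ.ae_summable hθ')]
      with ω hlam hprob hcf hsum n _ w hlen hadm x hx
    subst hlen
    set D := sInf ((fun b => (μ (S.θ^[w.length] ω)
      (shift '' cyl S (S.θinv (S.θ^[w.length] ω)) [b])).toReal) ''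
      {b : ℕ | wordAdm S (S.θinv (S.θ^[w.length] ω)) [b]})
    have hD0 : 0 ≤ D := by
      refine Real.sInf_nonneg ?_
      rintro _ ⟨_, -, rfl⟩
      exact ENNReal.toReal_nonneg
    have hBE := exp_distortion_le_Bconst hφ ω w.length (hsum w.length)
    suffices h : Real.exp (-distortion S κ r ω w.length) * D ≤ gibbsRatio S φ PG lam μ ω w x ∧
        gibbsRatio S φ PG lam μ ω w x ≤ Real.exp (distortion S κ r ω w.length) by
      refine ⟨(mul_le_mul_of_nonneg_right ?_ hD0).trans h.1, h.2.trans hBE⟩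
      rw [Real.exp_neg]
      exact inv_anti₀ (Real.exp_pos _) hBE
    rcases eq_or_ne w [] with rfl | hw
    · have : IsProbabilityMeasure (μ ω) := hprob 0
      have hratio : gibbsRatio S φ PG lam μ ω [] x = (μ ω (cyl S ω [])).toReal := by
        simp [gibbsRatio, Lam, birk]
      have hz : distortion S κ r ω ([] : List ℕ).length = 0 := by simp [distortion]
      rw [hratio, hz, neg_zero, Real.exp_zero, one_mul]
      exact ⟨sInf_le_fiber ω (μ ω), measureReal_le_one (μ := μ ω)⟩
    · have hinv : S.θinv (S.θ^[w.length] ω) = S.θ^[w.length - 1] ω := by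
        have hadd : w.length = 1 + (w.length - 1) := by
          have := List.length_pos_of_ne_nil hw
          omega
        conv_lhs => rw [hadd]
        exact θinv_iterate_θ_iterate _ 1
      refine gibbsRatio_bounds hφ D w hw ω (fun j => ⟨hlam j, hprob j, hcf j⟩) ?_ hadm x hx
      intro b hb
      rw [← hinv] at hb ⊢
      exact sInf_le_image _ _ hb

end RandomTMC
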